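/- Let d_A, d_B, d_E be positive natural numbers and V an isometry from ℂ^{d_A} to ℂ^{d_B} ⊗ ℂ^{d_E}, with associated channel Φ(ρ) = Tr_E(V ρ Vᴴ). Then for every Borel probability measure μ on the set S_{d_A} of states on ℂ^{d_A}, the entropic disturbance satisfies χ(μ) − χ(Φ(μ)) ≤ min(log d_A, 2·log d_E), where χ(μ) = H(ρ̄(μ)) − ∫ H(ρ) μ(dρ) and χ(Φ(μ)) = H(Φ(ρ̄(μ))) − ∫ H(Φ(ρ)) μ(dρ), with ρ̄(μ) = ∫ ρ μ(dρ) the barycenter of μ. -/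

import Mathlib

open MeasureTheory ComplexOrder Matrix

noncomputable section

instance matMS {m n : Type*} : MeasurableSpace (Matrix m n ℂ) :=
  inferInstanceAs (MeasurableSpace (m → n → ℂ))

instance matBS {m n : Type*} [Countable m] [Countable n] : BorelSpace (Matrix m n ℂ) :=
  inferInstanceAs (BorelSpace (m → n → ℂ))

/-- The set of quantum states (density matrices). -/
def stateSet (n : ℕ) : Set (Matrix (Fin n) (Fin n) ℂ) :=
  {ρ | ρ.PosSemidef ∧ ρ.trace = 1}

/-- Von Neumann entropy: sum of `negMulLog` over eigenvalues. -/
def vnEntropy {ι : Type*} [Fintype ι] [DecidableEq ι] (ρ : Matrix ι ι ℂ) : ℝ :=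
  if h : ρ.IsHermitian then ∑ i, Real.negMulLog (h.eigenvalues i) else 0

/-- Partial trace over the second (environment) factor. -/
def ptraceE {dB dE : ℕ} (M : Matrix (Fin dB × Fin dE) (Fin dB × Fin dE) ℂ) :
    Matrix (Fin dB) (Fin dB) ℂ :=
  Matrix.of fun b b' => ∑ e, M (b, e) (b', e)

/-- Partial trace over the first factor. -/
def ptraceB {dB dE : ℕ} (M : Matrix (Fin dB × Fin dE) (Fin dB × Fin dE) ℂ) :
    Matrix (Fin dE) (Fin dE) ℂ :=
  Matrix.of fun e e' => ∑ b, M (b, e) (b, e')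

/-- Quantum mutual information I(B:E) of a bipartite state. -/
def qmi {dB dE : ℕ} (ω : Matrix (Fin dB × Fin dE) (Fin dB × Fin dE) ℂ) : ℝ :=
  vnEntropy (ptraceE ω) + vnEntropy (ptraceB ω) - vnEntropy ω

/-- The channel `ρ ↦ Tr_E (V ρ V†)` associated with a Stinespring isometry `V`. -/
def chanPhi {dA dB dE : ℕ} (V : Matrix (Fin dB × Fin dE) (Fin dA) ℂ)
    (ρ : Matrix (Fin dA) (Fin dA) ℂ) : Matrix (Fin dB) (Fin dB) ℂ :=
  ptraceE (V * ρ * Vᴴ)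

/-- The complementary channel `ρ ↦ Tr_B (V ρ V†)`. -/
def chanPhiHat {dA dB dE : ℕ} (V : Matrix (Fin dB × Fin dE) (Fin dA) ℂ)
    (ρ : Matrix (Fin dA) (Fin dA) ℂ) : Matrix (Fin dE) (Fin dE) ℂ :=
  ptraceB (V * ρ * Vᴴ)

/-- Barycenter (average state) of a generalized ensemble. -/
def barycenter {n : ℕ} (μ : ProbabilityMeasure (stateSet n)) :
    Matrix (Fin n) (Fin n) ℂ :=
  Matrix.of fun i j => ∫ ρ : stateSet n, ρ.1 i j ∂(μ : Measure (stateSet n))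

/-- Output χ-quantity of a generalized ensemble under a map `Φ`. -/
def gChiOut {n d : ℕ} (Φ : Matrix (Fin n) (Fin n) ℂ → Matrix (Fin d) (Fin d) ℂ)
    (μ : ProbabilityMeasure (stateSet n)) : ℝ :=
  vnEntropy (Φ (barycenter μ)) -
    ∫ ρ : stateSet n, vnEntropy (Φ ρ.1) ∂(μ : Measure (stateSet n))

/-- χ-quantity of a generalized ensemble. -/
def gChi {n : ℕ} (μ : ProbabilityMeasure (stateSet n)) : ℝ :=
  vnEntropy (barycenter μ) -
    ∫ ρ : stateSet n, vnEntropy ρ.1 ∂(μ : Measure (stateSet n))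

/-- Holevo χ-quantity of a finite ensemble. -/
def finChi {d m : ℕ} (π : Fin m → ℝ) (σ : Fin m → Matrix (Fin d) (Fin d) ℂ) : ℝ :=
  vnEntropy (∑ i, π i • σ i) - ∑ i, π i * vnEntropy (σ i)

/-- The set of pure states (rank-one projections) viewed inside the state space. -/
def pureStates (n : ℕ) : Set (stateSet n) := {ρ | ρ.1 * ρ.1 = ρ.1}

end


open Real in
lemma sum_negMulLog_le {ι : Type*} [Fintype ι] [Nonempty ι] (p : ι → ℝ) (hp : ∀ i, 0 ≤ p i) :
    ∑ i, negMulLog (p i) ≤ negMulLog (∑ i, p i) + (∑ i, p i) * log (Fintype.card ι) := by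
  have hc : (0 : ℝ) < Fintype.card ι := by exact_mod_cast Fintype.card_pos
  have h := concaveOn_negMulLog.le_map_sum (t := Finset.univ)
    (w := fun _ : ι => (Fintype.card ι : ℝ)⁻¹) (p := p)
    (fun _ _ => by positivity) (by simp [hc.ne']) (fun i _ => hp i)
  simp only [smul_eq_mul, ← Finset.mul_sum] at h
  set s := ∑ i, p i
  have h2 : negMulLog ((Fintype.card ι : ℝ)⁻¹ * s) =
      (Fintype.card ι : ℝ)⁻¹ * (negMulLog s + s * log (Fintype.card ι)) := by
    rw [negMulLog_mul]
    simp [negMulLog]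
    ring
  rw [h2] at h
  exact le_of_mul_le_mul_left h (by positivity)

lemma psd_spec {ι : Type*} [Fintype ι] [DecidableEq ι] {M : Matrix ι ι ℂ} (hM : M.PosSemidef) :
    ∃ (U : Matrix ι ι ℂ) (l : ι → ℝ), Uᴴ * U = 1 ∧ U * Uᴴ = 1 ∧
      M = U * diagonal (fun i => (l i : ℂ)) * Uᴴ ∧ (∀ i, 0 ≤ l i) ∧
      ((∑ i, l i : ℝ) : ℂ) = M.trace ∧ vnEntropy M = ∑ i, Real.negMulLog (l i) := by
  have h1 := hM.1.spectral_theorem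
  rw [Unitary.conjStarAlgAut_apply] at h1
  have hU : ((hM.1.eigenvectorUnitary : Matrix ι ι ℂ))ᴴ * hM.1.eigenvectorUnitary = 1 :=
    Unitary.coe_star_mul_self _
  refine ⟨hM.1.eigenvectorUnitary, hM.1.eigenvalues, hU,
    Unitary.coe_mul_star_self _, h1, hM.eigenvalues_nonneg, ?_, ?_⟩
  · rw [hM.1.trace_eq_sum_eigenvalues]; simp
  · simp [vnEntropy, hM.1]

lemma vnEntropy_eq_roots {τ : Type*} [Fintype τ] [DecidableEq τ] (k : ℕ) (M : Matrix τ τ ℂ)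
    (h : M.IsHermitian) : vnEntropy M = ((Polynomial.X ^ k * M.charpoly).roots.map
        (fun z : ℂ => Real.negMulLog z.re)).sum := by
  rw [Polynomial.roots_mul (mul_ne_zero (pow_ne_zero _ Polynomial.X_ne_zero)
    (Matrix.charpoly_monic M).ne_zero), h.roots_charpoly_eq_eigenvalues]
  simp [vnEntropy, h, Multiset.map_nsmul, Multiset.sum_nsmul]

lemma vnEntropy_mul_comm {ι κ : Type*} [Fintype ι] [DecidableEq ι] [Fintype κ] [DecidableEq κ]
    (A : Matrix ι κ ℂ) (B : Matrix κ ι ℂ) (h1 : (A * B).IsHermitian) (h2 : (B * A).IsHermitian) :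
    vnEntropy (A * B) = vnEntropy (B * A) := by
  rw [vnEntropy_eq_roots (Fintype.card κ) _ h1, vnEntropy_eq_roots (Fintype.card ι) _ h2,
    Matrix.charpoly_mul_comm']

lemma normSq_row {ι : Type*} [Fintype ι] [DecidableEq ι] {U : Matrix ι ι ℂ} (h : U * Uᴴ = 1)
    (i : ι) : ∑ k, Complex.normSq (U i k) = 1 := by
  have := congrFun (congrFun h i) i
  simp only [mul_apply, conjTranspose_apply, one_apply_eq, RCLike.star_def, Complex.mul_conj] at this
  exact_mod_cast this

lemma normSq_col {ι : Type*} [Fintype ι] [DecidableEq ι] {U : Matrix ι ι ℂ} (h : Uᴴ * U = 1)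
    (k : ι) : ∑ i, Complex.normSq (U i k) = 1 := by
  have := congrFun (congrFun h k) k
  simp only [mul_apply, conjTranspose_apply, one_apply_eq, RCLike.star_def, mul_comm,
    Complex.mul_conj] at this
  exact_mod_cast this

lemma diag_spec {ι κ : Type*} [Fintype ι] [DecidableEq ι] [Fintype κ] [DecidableEq κ]
    (U : Matrix κ ι ℂ) (l : ι → ℝ) (i : κ) :
    (U * diagonal (fun i => (l i : ℂ)) * Uᴴ) i i =
      ((∑ k, Complex.normSq (U i k) * l k : ℝ) : ℂ) := by
  rw [mul_apply]
  push_cast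
  refine Finset.sum_congr rfl fun k _ => ?_
  rw [mul_diagonal, conjTranspose_apply, RCLike.star_def, ← Complex.mul_conj]
  ring

/-- Peierls inequality: the entropy is at most the entropy of the diagonal. -/
lemma vnEntropy_le_diag {ι : Type*} [Fintype ι] [DecidableEq ι] {M : Matrix ι ι ℂ}
    (hM : M.PosSemidef) : vnEntropy M ≤ ∑ i, Real.negMulLog (M i i).re := by
  obtain ⟨U, l, h1, h2, h3, h4, h5, h6⟩ := psd_spec hM
  rw [h6]
  have hd : ∀ i, (M i i).re = ∑ k, Complex.normSq (U i k) * l k := by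
    intro i
    rw [h3, diag_spec, Complex.ofReal_re]
  have hJ : ∀ i, ∑ k, Complex.normSq (U i k) * Real.negMulLog (l k) ≤
      Real.negMulLog (M i i).re := by
    intro i
    rw [hd]
    exact Real.concaveOn_negMulLog.le_map_sum (fun _ _ => Complex.normSq_nonneg _)
      (normSq_row h2 i) (fun k _ => h4 k)
  calc ∑ k, Real.negMulLog (l k)
      = ∑ k, (∑ i, Complex.normSq (U i k)) * Real.negMulLog (l k) := by
        simp [normSq_col h1]
    _ = ∑ i, ∑ k, Complex.normSq (U i k) * Real.negMulLog (l k) := by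
        rw [Finset.sum_comm]; simp [Finset.sum_mul]
    _ ≤ _ := Finset.sum_le_sum fun i _ => hJ i

lemma vnEntropy_le_conj_diag {ι : Type*} [Fintype ι] [DecidableEq ι] {M W : Matrix ι ι ℂ}
    (hM : M.PosSemidef) (hW : W * Wᴴ = 1) :
    vnEntropy M ≤ ∑ i, Real.negMulLog ((Wᴴ * M * W) i i).re := by
  have hP : (Wᴴ * M * W).PosSemidef := hM.conjTranspose_mul_mul_same W
  have e : W * (Wᴴ * M) = M := by rw [← Matrix.mul_assoc, hW, Matrix.one_mul]
  have := vnEntropy_mul_comm W (Wᴴ * M) (by rw [e]; exact hM.1) hP.1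
  rw [e] at this
  rw [this]
  exact vnEntropy_le_diag hP

lemma ptraceE_psd {dB dE : ℕ} {M : Matrix (Fin dB × Fin dE) (Fin dB × Fin dE) ℂ}
    (hM : M.PosSemidef) : (ptraceE M).PosSemidef := by
  have : ptraceE M = ∑ e, M.submatrix (fun b => (b, e)) (fun b => (b, e)) := by
    ext b b'
    simp [ptraceE, Matrix.sum_apply]
  rw [this]
  exact Matrix.posSemidef_sum _ fun e _ => hM.submatrix _

lemma ptraceE_trace {dB dE : ℕ} (M : Matrix (Fin dB × Fin dE) (Fin dB × Fin dE) ℂ) :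
    (ptraceE M).trace = M.trace := by
  simp [ptraceE, Matrix.trace, Fintype.sum_prod_type]

lemma ptraceE_conj {dB dE : ℕ} (M : Matrix (Fin dB × Fin dE) (Fin dB × Fin dE) ℂ)
    (U : Matrix (Fin dB) (Fin dB) ℂ) :
    ptraceE ((kroneckerMap (· * ·) U (1 : Matrix (Fin dE) (Fin dE) ℂ))ᴴ * M *
      (kroneckerMap (· * ·) U (1 : Matrix (Fin dE) (Fin dE) ℂ))) = Uᴴ * ptraceE M * U := by
  ext i j
  simp only [ptraceE, mul_apply, Fintype.sum_prod_type, conjTranspose_apply, kroneckerMap_apply,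
    one_apply, of_apply, mul_ite, mul_one, mul_zero, star_mul', apply_ite star, star_zero, star_one,
    ite_mul, zero_mul, Finset.sum_ite_eq, Finset.sum_ite_eq', Finset.mem_univ, if_true,
    Finset.mul_sum, Finset.sum_mul]
  rw [Finset.sum_comm]
  refine Finset.sum_congr rfl fun _ _ => ?_
  rw [Finset.sum_comm]

/-- Subadditivity with maximal environment entropy. -/
lemma vnEntropy_le_ptraceE_add {dB dE : ℕ} (hdE : 0 < dE)
    {M : Matrix (Fin dB × Fin dE) (Fin dB × Fin dE) ℂ}
    (hM : M.PosSemidef) (ht : M.trace = 1) :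
    vnEntropy M ≤ vnEntropy (ptraceE M) + Real.log dE := by
  have : Nonempty (Fin dE) := ⟨⟨0, hdE⟩⟩
  obtain ⟨U, l, h1, h2, h3, h4, h5, h6⟩ := psd_spec (ptraceE_psd hM)
  set W := kroneckerMap (· * ·) U (1 : Matrix (Fin dE) (Fin dE) ℂ) with hWdef
  have hW : W * Wᴴ = 1 := by
    rw [hWdef, conjTranspose_kronecker, ← mul_kronecker_mul, h2]
    simp
  have hP : (Wᴴ * M * W).PosSemidef := hM.conjTranspose_mul_mul_same W
  have hs : ∀ b, ∑ e, ((Wᴴ * M * W) (b, e) (b, e)).re = l b := by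
    intro b
    have h := congrFun (congrFun (ptraceE_conj M U) b) b
    rw [h3] at h
    have e : Uᴴ * (U * diagonal (fun i => (l i : ℂ)) * Uᴴ) * U = diagonal (fun i => (l i : ℂ)) := by
      calc _ = (Uᴴ * U) * diagonal (fun i => (l i : ℂ)) * (Uᴴ * U) := by
            simp only [Matrix.mul_assoc]
        _ = _ := by rw [h1]; simp
    rw [e, diagonal_apply_eq] at h
    rw [← Complex.ofReal_re (l b), ← h]
    simp [ptraceE, hWdef]
  refine (vnEntropy_le_conj_diag hM hW).trans ?_
  rw [Fintype.sum_prod_type, h6]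
  rw [ptraceE_trace, ht] at h5
  have h5' : ∑ i, l i = 1 := by exact_mod_cast h5
  calc _ ≤ ∑ b, (Real.negMulLog (l b) + l b * Real.log dE) := by
        refine Finset.sum_le_sum fun b _ => ?_
        have := sum_negMulLog_le (fun e => ((Wᴴ * M * W) (b, e) (b, e)).re)
          (fun e => (Complex.le_def.1 (hP.diag_nonneg (i := (b, e)))).1)
        rwa [hs, Fintype.card_fin] at this
    _ = _ := by rw [Finset.sum_add_distrib, ← Finset.sum_mul, h5', one_mul]

lemma vnEntropy_isometry {ι κ : Type*} [Fintype ι] [DecidableEq ι] [Fintype κ] [DecidableEq κ]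
    (V : Matrix κ ι ℂ) (hV : Vᴴ * V = 1) {ρ : Matrix ι ι ℂ} (hρ : ρ.PosSemidef) :
    vnEntropy (V * ρ * Vᴴ) = vnEntropy ρ := by
  have e : Vᴴ * (V * ρ) = ρ := by rw [← Matrix.mul_assoc, hV, Matrix.one_mul]
  rw [vnEntropy_mul_comm (V * ρ) Vᴴ (hρ.mul_mul_conjTranspose_same V).1 (by rw [e]; exact hρ.1), e]

/-- Araki-Lieb with maximal environment entropy. -/
lemma vnEntropy_chan_le {dA dB dE : ℕ} (hdE : 0 < dE)
    (V : Matrix (Fin dB × Fin dE) (Fin dA) ℂ) (hV : Vᴴ * V = 1)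
    {ρ : Matrix (Fin dA) (Fin dA) ℂ} (hρ : ρ.PosSemidef) (ht : ρ.trace = 1) :
    vnEntropy (chanPhi V ρ) ≤ vnEntropy ρ + Real.log dE := by
  have : Nonempty (Fin dE) := ⟨⟨0, hdE⟩⟩
  obtain ⟨U, l, h1, h2, h3, h4, h5, h6⟩ := psd_spec hρ
  rw [ht] at h5
  have h5' : ∑ i, l i = 1 := by exact_mod_cast h5
  set D : Matrix (Fin dA) (Fin dA) ℂ := diagonal (fun i => (Real.sqrt (l i) : ℂ)) with hD
  have hDD : D * D = diagonal (fun i => (l i : ℂ)) := by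
    rw [hD, diagonal_mul_diagonal]
    congr 1; ext i
    rw [← Complex.ofReal_mul, Real.mul_self_sqrt (h4 i)]
  have hDH : Dᴴ = D := by
    rw [hD, diagonal_conjTranspose]
    congr 1; ext i
    simp
  set R : Matrix (Fin dB × Fin dE) (Fin dA) ℂ := V * U * D with hR
  have hRR : R * Rᴴ = V * ρ * Vᴴ := by
    rw [hR, h3, conjTranspose_mul, conjTranspose_mul, hDH, ← hDD]
    simp only [Matrix.mul_assoc]
  have hRR' : Rᴴ * R = diagonal (fun i => (l i : ℂ)) := by
    rw [hR, conjTranspose_mul, conjTranspose_mul, hDH, ← hDD]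
    calc _ = D * (Uᴴ * (Vᴴ * V) * U) * D := by simp only [Matrix.mul_assoc]
      _ = _ := by rw [hV, Matrix.mul_one, h1, Matrix.mul_one]
  let X : Matrix (Fin dB) (Fin dA × Fin dE) ℂ := Matrix.of fun b p => R (b, p.2) p.1
  have hX : chanPhi V ρ = X * Xᴴ := by
    rw [chanPhi, ← hRR]
    ext b b'
    simp only [ptraceE, of_apply, mul_apply, conjTranspose_apply, X,
      Fintype.sum_prod_type]
    rw [Finset.sum_comm]
  have hG : (Xᴴ * X).PosSemidef := posSemidef_conjTranspose_mul_self X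
  rw [hX, vnEntropy_mul_comm X Xᴴ (posSemidef_self_mul_conjTranspose X).1 hG.1]
  refine (vnEntropy_le_diag hG).trans ?_
  have hs : ∀ k, ∑ e, ((Xᴴ * X) (k, e) (k, e)).re = l k := by
    intro k
    have h := congrFun (congrFun hRR' k) k
    rw [diagonal_apply_eq] at h
    rw [← Complex.ofReal_re (l k), ← h, ← Complex.re_sum]
    congr 1
    simp only [mul_apply, conjTranspose_apply, X, of_apply, Fintype.sum_prod_type]
    rw [Finset.sum_comm]
  rw [Fintype.sum_prod_type, h6]
  calc _ ≤ ∑ k, (Real.negMulLog (l k) + l k * Real.log dE) := by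
        refine Finset.sum_le_sum fun b _ => ?_
        have := sum_negMulLog_le (fun e => ((Xᴴ * X) (b, e) (b, e)).re)
          (fun e => (Complex.le_def.1 (hG.diag_nonneg (i := (b, e)))).1)
        rwa [hs, Fintype.card_fin] at this
    _ = _ := by rw [Finset.sum_add_distrib, ← Finset.sum_mul, h5', one_mul]

lemma state_spec {d : ℕ} {M : Matrix (Fin d) (Fin d) ℂ} (hM : M ∈ stateSet d) :
    ∃ (U : Matrix (Fin d) (Fin d) ℂ) (l : Fin d → ℝ), Uᴴ * U = 1 ∧ U * Uᴴ = 1 ∧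
      M = U * diagonal (fun i => (l i : ℂ)) * Uᴴ ∧ (∀ i, 0 ≤ l i) ∧ (∀ i, l i ≤ 1) ∧
      ∑ i, l i = 1 ∧ vnEntropy M = ∑ i, Real.negMulLog (l i) := by
  obtain ⟨U, l, h1, h2, h3, h4, h5, h6⟩ := psd_spec hM.1
  rw [hM.2] at h5
  have h5' : ∑ i, l i = 1 := by exact_mod_cast h5
  refine ⟨U, l, h1, h2, h3, h4, fun i => ?_, h5', h6⟩
  rw [← h5']
  exact Finset.single_le_sum (f := l) (fun i _ => h4 i) (Finset.mem_univ i)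

lemma entropy_nonneg {d : ℕ} {M : Matrix (Fin d) (Fin d) ℂ} (hM : M ∈ stateSet d) :
    0 ≤ vnEntropy M := by
  obtain ⟨U, l, h1, h2, h3, h4, h4', h5, h6⟩ := state_spec hM
  rw [h6]
  exact Finset.sum_nonneg fun i _ => Real.negMulLog_nonneg (h4 i) (h4' i)

lemma entropy_le_log {d : ℕ} (hd : 0 < d) {M : Matrix (Fin d) (Fin d) ℂ} (hM : M ∈ stateSet d) :
    vnEntropy M ≤ Real.log d := by
  have : Nonempty (Fin d) := ⟨⟨0, hd⟩⟩
  obtain ⟨U, l, h1, h2, h3, h4, h4', h5, h6⟩ := state_spec hM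
  have := sum_negMulLog_le l h4
  rw [h5] at this
  rw [h6]
  simpa using this

lemma trace_pow_spec {d : ℕ} {U : Matrix (Fin d) (Fin d) ℂ} (h1 : Uᴴ * U = 1) (h2 : U * Uᴴ = 1)
    (l : Fin d → ℝ) (k : ℕ) :
    ((U * diagonal (fun i => (l i : ℂ)) * Uᴴ) ^ k).trace.re = ∑ i, l i ^ k := by
  have : (U * diagonal (fun i => (l i : ℂ)) * Uᴴ) ^ k =
      U * (diagonal (fun i => (l i : ℂ))) ^ k * Uᴴ := by
    induction k with
    | zero => simp [h2]
    | succ k ih =>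
      rw [pow_succ, ih, pow_succ]
      calc _ = U * diagonal (fun i => (l i : ℂ)) ^ k * (Uᴴ * U) *
            diagonal (fun i => (l i : ℂ)) * Uᴴ := by simp only [Matrix.mul_assoc]
        _ = _ := by rw [h1]; simp only [Matrix.mul_assoc, Matrix.one_mul]
  rw [this, trace_mul_comm, ← Matrix.mul_assoc, h1, Matrix.one_mul, diagonal_pow, trace_diagonal]
  simp [← Complex.ofReal_pow]

lemma entry_norm_le {d : ℕ} {M : Matrix (Fin d) (Fin d) ℂ} (hM : M ∈ stateSet d) (i j : Fin d) :
    ‖M i j‖ ≤ 1 := by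
  obtain ⟨U, l, h1, h2, h3, h4, h4', h5, h6⟩ := state_spec hM
  have hU : U ∈ Matrix.unitaryGroup (Fin d) ℂ := mem_unitaryGroup_iff.2 h2
  rw [h3, mul_apply]
  refine (norm_sum_le _ _).trans ?_
  rw [← h5]
  refine Finset.sum_le_sum fun k _ => ?_
  rw [mul_diagonal, conjTranspose_apply, norm_mul, norm_mul, norm_star, Complex.norm_real,
    Real.norm_of_nonneg (h4 k)]
  have a := entry_norm_bound_of_unitary hU i k
  have b := entry_norm_bound_of_unitary hU j k
  calc ‖U i k‖ * l k * ‖U j k‖ ≤ 1 * l k * 1 := by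
        gcongr
        all_goals simpa using h4 k
    _ = l k := by ring

lemma measurable_entropy {Ω : Type*} [MeasurableSpace Ω] {d : ℕ}
    {F : Ω → Matrix (Fin d) (Fin d) ℂ} (hF : Measurable F) (hs : ∀ ω, F ω ∈ stateSet d) :
    Measurable (fun ω => vnEntropy (F ω)) := by
  have hp : ∀ n : ℕ, ∃ p : Polynomial ℝ, ∀ x ∈ Set.Icc (0 : ℝ) 1,
      |p.eval x - Real.negMulLog x| < 1 / ((n : ℝ) + 1) := fun n =>
    exists_polynomial_near_of_continuousOn 0 1 _ Real.continuous_negMulLog.continuousOn _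
      (by positivity)
  choose p hp using hp
  refine measurable_of_tendsto_metrizable
    (f := fun n ω => ∑ k ∈ (p n).support, (p n).coeff k * ((F ω) ^ k).trace.re) ?_ ?_
  · intro n
    refine Finset.measurable_sum _ fun k _ => Measurable.const_mul ?_ _
    have hc : Continuous fun M : Matrix (Fin d) (Fin d) ℂ => (M ^ k).trace.re :=
      Complex.continuous_re.comp (Continuous.matrix_trace (continuous_pow k))
    exact hc.measurable.comp hF
  · rw [tendsto_pi_nhds]
    intro ω
    obtain ⟨U, l, h1, h2, h3, h4, h4', h5, h6⟩ := state_spec (hs ω)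
    rw [tendsto_iff_dist_tendsto_zero]
    have hz : Filter.Tendsto (fun n : ℕ => (d : ℝ) * (1 / ((n : ℝ) + 1))) Filter.atTop (nhds 0) := by
      simpa using (tendsto_one_div_add_atTop_nhds_zero_nat (𝕜 := ℝ)).const_mul (d : ℝ)
    refine squeeze_zero (fun _ => dist_nonneg) (fun n => ?_) hz
    have e : ∑ k ∈ (p n).support, (p n).coeff k * ((F ω) ^ k).trace.re =
        ∑ i, (p n).eval (l i) := by
      simp_rw [h3, trace_pow_spec h1 h2, Polynomial.eval_eq_sum, Polynomial.sum, Finset.mul_sum]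
      rw [Finset.sum_comm]
    rw [e, h6, Real.dist_eq, ← Finset.sum_sub_distrib]
    refine (Finset.abs_sum_le_sum_abs _ _).trans ?_
    refine (Finset.sum_le_sum fun i _ => (hp n (l i) ⟨h4 i, h4' i⟩).le).trans ?_
    simp

lemma integrable_entropy {Ω : Type*} [MeasurableSpace Ω] (P : Measure Ω) [IsProbabilityMeasure P]
    {d : ℕ} (hd : 0 < d)
    {F : Ω → Matrix (Fin d) (Fin d) ℂ} (hF : Measurable F) (hs : ∀ ω, F ω ∈ stateSet d) :
    Integrable (fun ω => vnEntropy (F ω)) P := by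
  refine Integrable.of_bound (measurable_entropy hF hs).aestronglyMeasurable (Real.log d) ?_
  refine Filter.Eventually.of_forall fun ω => ?_
  rw [Real.norm_of_nonneg (entropy_nonneg (hs ω))]
  exact entropy_le_log hd (hs ω)

lemma measurable_entry {m n : ℕ} (i : Fin m) (j : Fin n) :
    Measurable (fun M : Matrix (Fin m) (Fin n) ℂ => M i j) :=
  (continuous_id.matrix_elem i j).measurable

lemma integrable_entry {Ω : Type*} [MeasurableSpace Ω] (P : Measure Ω) [IsProbabilityMeasure P]
    {d : ℕ}
    {F : Ω → Matrix (Fin d) (Fin d) ℂ} (hF : Measurable F) (hs : ∀ ω, F ω ∈ stateSet d)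
    (i j : Fin d) : Integrable (fun ω => F ω i j) P :=
  Integrable.of_bound ((measurable_entry i j).comp hF).aestronglyMeasurable 1
    (Filter.Eventually.of_forall fun ω => entry_norm_le (hs ω) i j)

lemma integral_sandwich {Ω : Type*} [MeasurableSpace Ω] (P : Measure Ω) [IsProbabilityMeasure P]
    {d : ℕ} {F : Ω → Matrix (Fin d) (Fin d) ℂ} (hF : Measurable F) (hs : ∀ ω, F ω ∈ stateSet d)
    {α β : Type*} (A : Matrix α (Fin d) ℂ) (C : Matrix (Fin d) β ℂ) (i : α) (j : β) :
    Integrable (fun ω => (A * F ω * C) i j) P ∧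
    ∫ ω, (A * F ω * C) i j ∂P = (A * (Matrix.of fun i j => ∫ ω, F ω i j ∂P) * C) i j := by
  have hI := integrable_entry P hF hs
  simp only [mul_apply, of_apply]
  have h1 : ∀ y, Integrable (fun ω => ∑ x, A i x * F ω x y) P := fun y =>
    integrable_finsetSum _ fun x _ => (hI x y).const_mul _
  refine ⟨integrable_finsetSum _ fun y _ => (h1 y).mul_const _, ?_⟩
  rw [integral_finsetSum _ fun y _ => (h1 y).mul_const _]
  refine Finset.sum_congr rfl fun y _ => ?_
  rw [integral_mul_const, integral_finsetSum _ fun x _ => (hI x y).const_mul _]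
  simp_rw [integral_const_mul]

lemma bary_state {Ω : Type*} [MeasurableSpace Ω] (P : Measure Ω) [IsProbabilityMeasure P]
    {d : ℕ} {F : Ω → Matrix (Fin d) (Fin d) ℂ} (hF : Measurable F) (hs : ∀ ω, F ω ∈ stateSet d) :
    (Matrix.of fun i j => ∫ ω, F ω i j ∂P) ∈ stateSet d := by
  have hI := integrable_entry P hF hs
  refine ⟨PosSemidef.of_dotProduct_mulVec_nonneg ?_ ?_, ?_⟩
  · ext i j
    simp only [conjTranspose_apply, of_apply, RCLike.star_def]
    rw [← integral_conj]
    congr 1; ext ω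
    exact congrFun (congrFun (hs ω).1.1 i) j
  · intro x
    have e : ∀ M : Matrix (Fin d) (Fin d) ℂ, star x ⬝ᵥ (M *ᵥ x) =
        (replicateRow Unit (star x) * M * replicateCol Unit x) () () := by
      intro M
      rw [dotProduct_mulVec]
      rfl
    rw [e, ← (integral_sandwich P hF hs _ _ _ _).2]
    have h0 : ∀ ω, 0 ≤ (replicateRow Unit (star x) * F ω * replicateCol Unit x) () () := by
      intro ω
      rw [← e]
      exact (hs ω).1.dotProduct_mulVec_nonneg x
    exact integral_nonneg h0
  · simp only [trace, diag_apply, of_apply]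
    rw [← integral_finsetSum _ fun i _ => hI i i]
    have : ∀ ω, ∑ i, F ω i i = 1 := fun ω => (hs ω).2
    simp [this]

/-- Concavity of the von Neumann entropy, integral form. -/
lemma jensen_entropy {Ω : Type*} [MeasurableSpace Ω] (P : Measure Ω) [IsProbabilityMeasure P]
    {d : ℕ} (hd : 0 < d)
    {F : Ω → Matrix (Fin d) (Fin d) ℂ} (hF : Measurable F) (hs : ∀ ω, F ω ∈ stateSet d) :
    ∫ ω, vnEntropy (F ω) ∂P ≤ vnEntropy (Matrix.of fun i j => ∫ ω, F ω i j ∂P) := by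
  obtain ⟨U, l, h1, h2, h3, h4, h4', h5, h6⟩ := state_spec (bary_state P hF hs)
  rw [h6]
  have hS := fun i => integral_sandwich P hF hs Uᴴ U i i
  have hl : ∀ i, ∫ ω, ((Uᴴ * F ω * U) i i).re ∂P = l i := by
    intro i
    have h := (hS i).2
    have e : Uᴴ * (U * diagonal (fun i => (l i : ℂ)) * Uᴴ) * U = diagonal (fun i => (l i : ℂ)) := by
      calc _ = (Uᴴ * U) * diagonal (fun i => (l i : ℂ)) * (Uᴴ * U) := by
            simp only [Matrix.mul_assoc]
        _ = _ := by rw [h1]; simp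
    rw [h3, e, diagonal_apply_eq] at h
    have h' := integral_re (hS i).1
    simp only [RCLike.re_to_complex] at h'
    rw [h', h, Complex.ofReal_re]
  have hst : ∀ ω, (Uᴴ * F ω * U) ∈ stateSet d := fun ω =>
    ⟨(hs ω).1.conjTranspose_mul_mul_same U, by
      rw [trace_mul_comm, ← Matrix.mul_assoc, h2, Matrix.one_mul, (hs ω).2]⟩
  have h0 : ∀ ω i, 0 ≤ ((Uᴴ * F ω * U) i i).re := fun ω i =>
    (Complex.le_def.1 ((hst ω).1.diag_nonneg (i := i))).1
  have h01 : ∀ ω i, ((Uᴴ * F ω * U) i i).re ≤ 1 := fun ω i =>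
    (Complex.re_le_norm _).trans (entry_norm_le (hst ω) i i)
  have hre : ∀ i, Integrable (fun ω => ((Uᴴ * F ω * U) i i).re) P := fun i => (hS i).1.re
  obtain ⟨c, hc⟩ := (isCompact_Icc (a := (0 : ℝ)) (b := 1)).exists_bound_of_continuousOn
    Real.continuous_negMulLog.continuousOn
  have hg : ∀ i, Integrable (fun ω => Real.negMulLog ((Uᴴ * F ω * U) i i).re) P := fun i =>
    Integrable.of_bound (Real.continuous_negMulLog.comp_aestronglyMeasurable
      (hre i).aestronglyMeasurable) c
      (Filter.Eventually.of_forall fun ω => hc _ ⟨h0 ω i, h01 ω i⟩)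
  calc ∫ ω, vnEntropy (F ω) ∂P
      ≤ ∫ ω, ∑ i, Real.negMulLog ((Uᴴ * F ω * U) i i).re ∂P :=
        integral_mono (integrable_entropy P hd hF hs) (integrable_finsetSum _ fun i _ => hg i)
          fun ω => vnEntropy_le_conj_diag (hs ω).1 h2
    _ = ∑ i, ∫ ω, Real.negMulLog ((Uᴴ * F ω * U) i i).re ∂P :=
        integral_finsetSum _ fun i _ => hg i
    _ ≤ ∑ i, Real.negMulLog (l i) := by
        refine Finset.sum_le_sum fun i _ => ?_
        rw [← hl i]
        exact Real.concaveOn_negMulLog.le_map_integral Real.continuous_negMulLog.continuousOn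
          isClosed_Ici (Filter.Eventually.of_forall fun ω => h0 ω i) (hre i) (hg i)

lemma isometry_state {dA : ℕ} {dB dE : ℕ} (V : Matrix (Fin dB × Fin dE) (Fin dA) ℂ)
    (hV : Vᴴ * V = 1) {ρ : Matrix (Fin dA) (Fin dA) ℂ} (h : ρ ∈ stateSet dA) :
    (V * ρ * Vᴴ).PosSemidef ∧ (V * ρ * Vᴴ).trace = 1 :=
  ⟨h.1.mul_mul_conjTranspose_same V, by
    rw [trace_mul_comm, ← Matrix.mul_assoc, hV, Matrix.one_mul, h.2]⟩

lemma chanPhi_state {dA : ℕ} {dB dE : ℕ} (V : Matrix (Fin dB × Fin dE) (Fin dA) ℂ)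
    (hV : Vᴴ * V = 1) {ρ : Matrix (Fin dA) (Fin dA) ℂ} (h : ρ ∈ stateSet dA) :
    chanPhi V ρ ∈ stateSet dB :=
  ⟨ptraceE_psd (isometry_state V hV h).1, by
    rw [chanPhi, ptraceE_trace, (isometry_state V hV h).2]⟩

lemma continuous_chanPhi {dA dB dE : ℕ} (V : Matrix (Fin dB × Fin dE) (Fin dA) ℂ) :
    Continuous (chanPhi V) := by
  have h : Continuous fun ρ : Matrix (Fin dA) (Fin dA) ℂ => V * ρ * Vᴴ := by fun_prop
  refine continuous_matrix fun b b' => ?_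
  simp only [chanPhi, ptraceE, of_apply]
  exact continuous_finsetSum _ fun e _ => h.matrix_elem _ _

/-- The entropic disturbance of any generalized ensemble is bounded by
`min (log d_A) (2 log d_E)`. -/
theorem gEntropic_disturbance_le_min
    (dA dB dE : ℕ) (hdA : 0 < dA) (hdB : 0 < dB) (hdE : 0 < dE)
    (V : Matrix (Fin dB × Fin dE) (Fin dA) ℂ) (hV : Vᴴ * V = 1)
    (μ : ProbabilityMeasure (stateSet dA)) :
    gChi μ - gChiOut (chanPhi V) μ ≤ min (Real.log dA) (2 * Real.log dE) := by

  have hm : Measurable (fun ρ : stateSet dA => ρ.1) := measurable_subtype_coe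
  have hs : ∀ ρ : stateSet dA, ρ.1 ∈ stateSet dA := fun ρ => ρ.2
  have hm' : Measurable (fun ρ : stateSet dA => chanPhi V ρ.1) :=
    (continuous_chanPhi V).measurable.comp hm
  have hs' : ∀ ρ : stateSet dA, chanPhi V ρ.1 ∈ stateSet dB := fun ρ => chanPhi_state V hV ρ.2
  set P : Measure (stateSet dA) := (μ : Measure (stateSet dA)) with hP
  have hb : barycenter μ ∈ stateSet dA := bary_state P hm hs
  have hbc : chanPhi V (barycenter μ) =
      Matrix.of fun i j => ∫ ρ : stateSet dA, chanPhi V ρ.1 i j ∂P := by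
    ext b b'
    simp only [chanPhi, ptraceE, of_apply]
    rw [integral_finsetSum _ fun e _ => (integral_sandwich P hm hs V Vᴴ (b, e) (b', e)).1]
    exact Finset.sum_congr rfl fun e _ =>
      (integral_sandwich P hm hs V Vᴴ (b, e) (b', e)).2.symm
  have i1 := integrable_entropy P hdA hm hs
  have i2 := integrable_entropy P hdB hm' hs'
  unfold gChi gChiOut
  rw [← hP]
  refine le_min ?_ ?_
  · have a1 := entropy_le_log hdA hb
    have a2 : 0 ≤ ∫ ρ : stateSet dA, vnEntropy ρ.1 ∂P :=
      integral_nonneg fun ρ => entropy_nonneg ρ.2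
    have a3 := jensen_entropy P hdB hm' hs'
    rw [← hbc] at a3
    linarith
  · have a1 : vnEntropy (barycenter μ) ≤ vnEntropy (chanPhi V (barycenter μ)) + Real.log dE := by
      rw [← vnEntropy_isometry V hV hb.1]
      exact vnEntropy_le_ptraceE_add hdE (isometry_state V hV hb).1 (isometry_state V hV hb).2
    have a2 : ∫ ρ : stateSet dA, vnEntropy (chanPhi V ρ.1) ∂P ≤
        ∫ ρ : stateSet dA, (vnEntropy ρ.1 + Real.log dE) ∂P :=
      integral_mono i2 (i1.add (integrable_const _)) fun ρ =>
        vnEntropy_chan_le hdE V hV ρ.2.1 ρ.2.2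
    rw [integral_add i1 (integrable_const _)] at a2
    simp only [integral_const, probReal_univ, one_smul] at a2
    linarith
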